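/- Let N, k ∈ ℕ and let ξ ∈ ℓ²(F_∞^k) be a unit vector. Define the complex N^k × N^k matrix X indexed by v,w ∈ {1,…,N}^k with entries X_{vw} = N^{-k}⟨U_w ξ, U_v ξ⟩ − N^{-k}δ_{vw}. Then ‖X‖₂ ≤ N^{-k/2} · √((1 + 9/N)^k − 1). (X is the difference between the output of the complementary channel of Φ_N^{⊗k} at the pure state |ξ⟩⟨ξ| and the maximally mixed state N^{-k}·Id, where Φ_N(ρ) = N^{-1}Σ_{i=1}^N U_i ρ U_i^*.) -/

import Mathlib

open scoped ENNReal

noncomputable section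

/-- The free group on countably many generators. -/
abbrev FG : Type := FreeGroup ℕ

/-- The generators `g_i` of the free group. -/
def gen (i : ℕ) : FG := FreeGroup.of i

/-- `ℓ²(F_∞^k)`. -/
abbrev l2 (k : ℕ) : Type := lp (fun _ : Fin k → FG => ℂ) 2

/-- The Hilbert–Schmidt (Frobenius) norm of a matrix. -/
def frobNorm {ι : Type*} [Fintype ι] (a : ι → ι → ℂ) : ℝ :=
  Real.sqrt (∑ v : ι, ∑ w : ι, ‖a v w‖ ^ 2)

/-- The inner product `⟨U_w ξ, U_v ξ⟩ = Σ_x conj((U_w ξ)(x)) (U_v ξ)(x)`, where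
`(U_v ξ)(x) = ξ(g_{v_1}^{-1}x_1, …, g_{v_k}^{-1}x_k)`. -/
def innerUU {N k : ℕ} (ξ : l2 k) (w v : Fin k → Fin N) : ℂ :=
  ∑' x : Fin k → FG,
    (starRingEnd ℂ) (ξ (fun j => (gen (w j : ℕ))⁻¹ * x j)) *
      ξ (fun j => (gen (v j : ℕ))⁻¹ * x j)

lemma ENNReal.two_mul_mul_le_add_sq (a b : ℝ≥0∞) : 2 * a * b ≤ a ^ 2 + b ^ 2 := by
  induction a using ENNReal.recTopCoe with
  | top => simp
  | coe a =>
    induction b using ENNReal.recTopCoe with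
    | top => simp
    | coe b => exact_mod_cast two_mul_le_add_sq a b

/-- The Cauchy–Schwarz inequality for sums in `ℝ≥0∞`. -/
lemma ENNReal.sq_tsum_mul_le {α : Type*} (f g : α → ℝ≥0∞) :
    (∑' x, f x * g x) ^ 2 ≤ (∑' x, f x ^ 2) * ∑' x, g x ^ 2 := by
  have key : 2 * (∑' x, ∑' y, (f x * g x) * (f y * g y)) ≤
      2 * ∑' x, ∑' y, f x ^ 2 * g y ^ 2 := by
    conv_rhs => rw [two_mul]; enter [2]; rw [ENNReal.tsum_comm]
    simp_rw [← ENNReal.tsum_add, ← ENNReal.tsum_mul_left]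
    refine ENNReal.tsum_le_tsum fun x => ENNReal.tsum_le_tsum fun y => ?_
    calc 2 * (f x * g x * (f y * g y)) = 2 * (f x * g y) * (f y * g x) := by ring
      _ ≤ _ := ENNReal.two_mul_mul_le_add_sq _ _
      _ = _ := by ring
  rw [ENNReal.mul_le_mul_iff_right two_ne_zero ENNReal.ofNat_ne_top] at key
  simpa only [sq, ENNReal.tsum_mul_left, ENNReal.tsum_mul_right] using key

/-- A Cauchy–Schwarz inequality in which only pairs carrying the same label `τ` appear, at the cost
of the number of labels. -/
lemma ENNReal.sq_tsum_mul_le_card_mul {α T : Type*} [Fintype T] [DecidableEq T] (S : Finset T)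
    (τ : α → T) (hτ : ∀ x, τ x ∈ S) (f g : α → ℝ≥0∞) :
    (∑' x, f x * g x) ^ 2 ≤
      S.card * ∑' x, ∑' y, f x ^ 2 * g y ^ 2 * if τ x = τ y then 1 else 0 := by
  have hsplit : ∑' x, f x * g x = ∑' t : T, (∑' x, (if τ x = t then f x else 0) *
      (if τ x = t then g x else 0)) * if t ∈ S then 1 else 0 := by
    simp_rw [← ENNReal.tsum_mul_right]
    rw [ENNReal.tsum_comm]
    refine tsum_congr fun x => ?_
    rw [tsum_eq_single (τ x) (fun t ht => by simp [ht.symm])]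
    simp [hτ x]
  have hcard : (∑' t : T, (if t ∈ S then (1 : ℝ≥0∞) else 0) ^ 2) = S.card := by
    simp [tsum_fintype, ite_pow]
  rw [hsplit]
  refine (ENNReal.sq_tsum_mul_le _ _).trans ?_
  rw [hcard, mul_comm]
  gcongr
  refine (ENNReal.tsum_le_tsum fun t => ENNReal.sq_tsum_mul_le _ _).trans (le_of_eq ?_)
  simp_rw [← ENNReal.tsum_mul_right]
  simp_rw [← ENNReal.tsum_mul_left]
  rw [ENNReal.tsum_comm]
  refine tsum_congr fun x => ?_
  rw [ENNReal.tsum_comm]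
  refine tsum_congr fun y => ?_
  rw [tsum_eq_single (τ x) (fun t ht => by simp [ht.symm])]
  by_cases h : τ x = τ y
  · simp [h, mul_comm]
  · simp [h, Ne.symm h]

lemma toWord_gen_inv_mul {i : ℕ} {x : FG} (h : x.toWord.head? ≠ some (i, true)) :
    ((gen i)⁻¹ * x).toWord = (i, false) :: x.toWord := by
  rw [FreeGroup.toWord_mul, gen, FreeGroup.toWord_inv, FreeGroup.toWord_of]
  simp only [FreeGroup.invRev, List.map_cons, List.map_nil, List.reverse_singleton,
    List.singleton_append, FreeGroup.reduce.cons, FreeGroup.reduce_toWord]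
  cases hx : x.toWord with
  | nil => rfl
  | cons a L =>
    obtain ⟨a, b⟩ := a
    have : ¬ (i = a ∧ b = true) := by
      rintro ⟨rfl, rfl⟩
      simp [hx] at h
    simp only [Bool.not_true]
    rw [if_neg]
    rintro ⟨h1, h2⟩
    exact this ⟨h1, by simpa using h2⟩

/-- Says whether the reduced word of `x` begins with `g_w`, with `g_v`, or with neither
(the latter also when `w = v`). -/
def label (w v : ℕ) (x : FG) : Fin 3 :=
  if w = v then 0 else if x.toWord.head? = some (w, true) then 1
    else if x.toWord.head? = some (v, true) then 2 else 0

lemma gen_mul_toWord {i : ℕ} {y : FG} (h : (gen i * y).toWord.head? ≠ some (i, true)) :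
    y.toWord = (i, false) :: (gen i * y).toWord := by
  simpa using toWord_gen_inv_mul h

/-- Two words and a label determine the pair of generators. -/
lemma label_injOn {w v w' v' : ℕ} {y z : FG} (hne : w ≠ v) (hne' : w' ≠ v')
    (h : label w v (gen w * y) = label w v (gen v * z))
    (h' : label w' v' (gen w' * y) = label w' v' (gen v' * z))
    (hl : label w v (gen w * y) = label w' v' (gen w' * y)) : w = w' ∧ v = v' := by
  have one {w v : ℕ} (hne : w ≠ v) {x : FG} (h : label w v x = 1) :
      x.toWord.head? = some (w, true) := by
    grind [label]
  have two {w v : ℕ} (hne : w ≠ v) {x : FG} (h : label w v x = 2) :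
      x.toWord.head? = some (v, true) := by
    grind [label]
  have zero {w v : ℕ} (hne : w ≠ v) {x : FG} (h : label w v x = 0) :
      x.toWord.head? ≠ some (w, true) ∧ x.toWord.head? ≠ some (v, true) := by
    grind [label]
  rw [h] at hl
  have hl' : label w v (gen v * z) = label w' v' (gen v' * z) := hl.trans h'
  generalize hc : label w v (gen v * z) = c at *
  obtain rfl | rfl | rfl : c = 0 ∨ c = 1 ∨ c = 2 := by omega
  · have a1 := gen_mul_toWord (zero hne h).1
    have a2 := gen_mul_toWord (zero hne' hl.symm).1
    have b1 := gen_mul_toWord (zero hne hc).2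
    have b2 := gen_mul_toWord (zero hne' hl'.symm).2
    grind
  · have s1 := one hne hc
    have s2 := one hne' hl'.symm
    have b1 := gen_mul_toWord (i := v) (y := z) (by rw [s1]; simpa using hne)
    have b2 := gen_mul_toWord (i := v') (y := z) (by rw [s2]; simpa using hne')
    grind
  · have s1 := two hne h
    have s2 := two hne' hl.symm
    have b1 := gen_mul_toWord (i := w) (y := y) (by rw [s1]; simpa using hne.symm)
    have b2 := gen_mul_toWord (i := w') (y := y) (by rw [s2]; simpa using hne'.symm)
    grind

/-- The number of labels used for the pair `(w, v)` if `g_w y` and `g_v z` have the same label, and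
`0` otherwise. -/
def labelWeight (w v : ℕ) (y z : FG) : ℝ≥0∞ :=
  (if w = v then 1 else 3) * if label w v (gen w * y) = label w v (gen v * z) then 1 else 0

lemma card_label_eq_le (N : ℕ) (y z : FG) :
    (Finset.univ.filter fun p : Fin N × Fin N => p.1 ≠ p.2 ∧
      label p.2 p.1 (gen p.2 * y) = label p.2 p.1 (gen p.1 * z)).card ≤ 3 := by
  have := Finset.card_le_card_of_injOn (s := Finset.univ.filter fun p : Fin N × Fin N =>
      p.1 ≠ p.2 ∧ label p.2 p.1 (gen p.2 * y) = label p.2 p.1 (gen p.1 * z))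
    (t := (Finset.univ : Finset (Fin 3))) (fun p => label p.2 p.1 (gen p.2 * y))
    (fun _ _ => Finset.mem_coe.2 (Finset.mem_univ _)) ?_
  · simpa using this
  · rintro ⟨v, w⟩ hp ⟨v', w'⟩ hp' hl
    simp only [Finset.coe_filter, Finset.mem_univ, true_and, Set.mem_ofPred_eq] at hp hp'
    have := label_injOn (fun e => hp.1 (Fin.ext e.symm)) (fun e => hp'.1 (Fin.ext e.symm))
      hp.2 hp'.2 hl
    exact Prod.ext (Fin.ext this.2) (Fin.ext this.1)

lemma sum_labelWeight_le (N : ℕ) (y z : FG) :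
    ∑ v : Fin N, ∑ w : Fin N, labelWeight w v y z ≤ N + 9 := by
  have hle (v w : Fin N) : labelWeight w v y z = (if v = w then 1 else 0) + 3 *
      if v ≠ w ∧ label w v (gen w * y) = label w v (gen v * z) then 1 else 0 := by
    by_cases h : v = w
    · subst h; simp [labelWeight, label]
    · have : (w : ℕ) ≠ v := fun e => h (Fin.ext e.symm)
      simp [labelWeight, h, this]
  simp_rw [hle, Finset.sum_add_distrib, ← Finset.mul_sum]
  rw [← Fintype.sum_prod_type' (f := fun v w : Fin N => if v ≠ w ∧
    label w v (gen w * y) = label w v (gen v * z) then (1 : ℝ≥0∞) else 0), Finset.sum_boole]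
  simp only [Finset.sum_ite_eq, Finset.mem_univ, if_true, Finset.sum_const, Finset.card_univ,
    Fintype.card_fin, nsmul_eq_mul, mul_one]
  gcongr
  calc (3 : ℝ≥0∞) * _ ≤ 3 * (3 : ℕ) := by
        gcongr
        exact card_label_eq_le N y z
    _ = 9 := by norm_num

/-- Left translation of `F_∞^k` by `(g_{v_1}^{-1}, …, g_{v_k}^{-1})`. -/
def genShift {N k : ℕ} (v : Fin k → Fin N) : (Fin k → FG) ≃ (Fin k → FG) :=
  Equiv.mulLeft (fun j => gen (v j : ℕ))⁻¹

lemma enorm_innerUU_sq_le {N k : ℕ} (ξ : l2 k) (w v : Fin k → Fin N) :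
    ‖innerUU ξ w v‖ₑ ^ 2 ≤
      ∑' y, ∑' z, ‖ξ y‖ₑ ^ 2 * ‖ξ z‖ₑ ^ 2 * ∏ j, labelWeight (w j) (v j) (y j) (z j) := by
  set τ : (Fin k → FG) → (Fin k → Fin 3) := fun x j => label (w j) (v j) (x j) with hτ
  set S : Finset (Fin k → Fin 3) :=
    Fintype.piFinset fun j => if (w j : ℕ) = v j then {0} else Finset.univ with hS
  have hmem (x) : τ x ∈ S := by
    rw [hS, Fintype.mem_piFinset]
    intro j
    by_cases h : (w j : ℕ) = v j <;> simp [hτ, h, label]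
  have hcard : (S.card : ℝ≥0∞) = ∏ j, if (w j : ℕ) = v j then 1 else 3 := by
    rw [hS, Fintype.card_piFinset, Nat.cast_prod]
    refine Finset.prod_congr rfl fun j _ => ?_
    split_ifs <;> simp
  have h1 : ‖innerUU ξ w v‖ₑ ≤ ∑' x, ‖ξ (genShift w x)‖ₑ * ‖ξ (genShift v x)‖ₑ := by
    refine enorm_tsum_le_tsum_enorm.trans (le_of_eq (tsum_congr fun x => ?_))
    rw [enorm_mul]
    congr 1
    simp only [enorm_eq_nnnorm, RCLike.nnnorm_conj]
    rfl
  refine (pow_le_pow_left₀ (zero_le) h1 2).trans ?_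
  refine (ENNReal.sq_tsum_mul_le_card_mul S τ hmem _ _).trans (le_of_eq ?_)
  rw [← (genShift w).symm.tsum_eq, ← ENNReal.tsum_mul_left]
  refine tsum_congr fun y => ?_
  rw [← (genShift v).symm.tsum_eq, ← ENNReal.tsum_mul_left]
  refine tsum_congr fun z => ?_
  simp only [Equiv.apply_symm_apply, labelWeight, Finset.prod_mul_distrib, hcard]
  have : (if τ ((genShift w).symm y) = τ ((genShift v).symm z) then (1 : ℝ≥0∞) else 0) =
      ∏ j, if label (w j) (v j) (gen (w j) * y j) = label (w j) (v j) (gen (v j) * z j)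
        then 1 else 0 := by
    rw [Finset.prod_ite_zero]
    simp [hτ, funext_iff, genShift]
  rw [this]
  ring

lemma tsum_enorm_sq {k : ℕ} (ξ : l2 k) (hξ : ‖ξ‖ = 1) :
    HasSum (fun x => ‖ξ x‖ ^ 2) 1 ∧ ∑' x, ‖ξ x‖ₑ ^ 2 = 1 := by
  have h := lp.hasSum_norm (p := 2) (by norm_num) ξ
  simp only [hξ, ENNReal.toReal_ofNat, Real.rpow_ofNat, one_pow] at h
  refine ⟨h, ?_⟩
  have := ENNReal.ofReal_tsum_of_nonneg (fun x => sq_nonneg ‖ξ x‖) h.summable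
  rw [h.tsum_eq] at this
  simpa [ENNReal.ofReal_pow] using this.symm

lemma innerUU_self {N k : ℕ} (ξ : l2 k) (hξ : ‖ξ‖ = 1) (v : Fin k → Fin N) :
    innerUU ξ v v = 1 := by
  have h := ((genShift v).hasSum_iff.2 (tsum_enorm_sq ξ hξ).1).mapL Complex.ofRealCLM
  rw [innerUU, ← map_one Complex.ofRealHom]
  refine Eq.trans (tsum_congr fun x => ?_) h.tsum_eq
  rw [Complex.conj_mul']
  simp [genShift]
  rfl

lemma sum_tsum_labelWeight_le {N k : ℕ} (p : (Fin k → FG) → ℝ≥0∞) (hp : ∑' x, p x = 1) :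
    ∑ v : Fin k → Fin N, ∑ w : Fin k → Fin N, ∑' y, ∑' z,
      p y * p z * ∏ j, labelWeight (w j) (v j) (y j) (z j) ≤ (N + 9) ^ k := by
  calc
    _ = ∑' y, ∑' z, p y * p z *
        ∏ j, ∑ a : Fin N, ∑ b : Fin N, labelWeight b a (y j) (z j) := by
      simp_rw [Fintype.prod_sum, Finset.mul_sum,
        Summable.tsum_finsetSum fun _ _ => ENNReal.summable]
    _ ≤ ∑' y, ∑' z, p y * p z * (N + 9) ^ k := by
      gcongr with y z
      refine (Finset.prod_le_pow_card _ _ _ fun j _ => sum_labelWeight_le N (y j) (z j)).trans ?_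
      simp
    _ = (N + 9) ^ k := by
      simp_rw [ENNReal.tsum_mul_right, ENNReal.tsum_mul_left, hp, mul_one, hp, one_mul]

lemma sum_enorm_innerUU_sq_le {N k : ℕ} (ξ : l2 k) (hξ : ‖ξ‖ = 1) :
    ∑ v : Fin k → Fin N, ∑ w : Fin k → Fin N, ‖innerUU ξ w v‖ₑ ^ 2 ≤ (N + 9) ^ k :=
  (Finset.sum_le_sum fun v _ => Finset.sum_le_sum fun w _ => enorm_innerUU_sq_le ξ w v).trans
    (sum_tsum_labelWeight_le (fun x => ‖ξ x‖ₑ ^ 2) (tsum_enorm_sq ξ hξ).2)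

lemma sum_norm_innerUU_sq_le {N k : ℕ} (ξ : l2 k) (hξ : ‖ξ‖ = 1) :
    ∑ v : Fin k → Fin N, ∑ w : Fin k → Fin N, ‖innerUU ξ w v‖ ^ 2 ≤ ((N : ℝ) + 9) ^ k := by
  have h := sum_enorm_innerUU_sq_le (N := N) ξ hξ
  have := ENNReal.toReal_mono (by finiteness) h
  rw [ENNReal.toReal_sum fun _ _ =>
    ENNReal.sum_ne_top.2 fun _ _ => ENNReal.pow_ne_top enorm_ne_top] at this
  simp_rw [ENNReal.toReal_sum (fun _ _ => ENNReal.pow_ne_top enorm_ne_top)] at this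
  rw [ENNReal.toReal_pow, ENNReal.toReal_add (by finiteness) (by finiteness)] at this
  simpa using this

/-- For a unit vector `ξ ∈ ℓ²(F_∞^k)`, the matrix
`X_{vw} = N^{-k}⟨U_w ξ, U_v ξ⟩ − N^{-k}δ_{vw}` — the difference between the output of
the complementary channel of `Φ_N^{⊗k}` at `|ξ⟩⟨ξ|` and the maximally mixed state —
satisfies `‖X‖₂ ≤ N^{-k/2} √((1+9/N)^k − 1)`. -/
theorem comp_channel_output_close_to_mixed (N k : ℕ) (ξ : l2 k) (hξ : ‖ξ‖ = 1) :
    frobNorm (fun v w : Fin k → Fin N =>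
        ((N : ℂ) ^ k)⁻¹ * innerUU ξ w v - if v = w then ((N : ℂ) ^ k)⁻¹ else 0)
      ≤ Real.sqrt ((1 + 9 / (N : ℝ)) ^ k - 1) / (N : ℝ) ^ ((k : ℝ) / 2) := by
  have hsqrt : (N : ℝ) ^ ((k : ℝ) / 2) = Real.sqrt ((N : ℝ) ^ k) := by
    rw [Real.sqrt_eq_rpow, ← Real.rpow_natCast, ← Real.rpow_mul (Nat.cast_nonneg N)]
    ring_nf
  rw [hsqrt, ← Real.sqrt_div' _ (by positivity), frobNorm]
  apply Real.sqrt_le_sqrt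
  have hentry (v w : Fin k → Fin N) :
      ‖((N : ℂ) ^ k)⁻¹ * innerUU ξ w v - if v = w then ((N : ℂ) ^ k)⁻¹ else 0‖ ^ 2 =
        (((N : ℝ) ^ k)⁻¹) ^ 2 * (‖innerUU ξ w v‖ ^ 2 - if v = w then 1 else 0) := by
    split_ifs with h
    · subst h
      simp [innerUU_self ξ hξ]
    · simp [mul_pow]
  simp_rw [hentry, ← Finset.mul_sum, Finset.sum_sub_distrib]
  simp only [Finset.sum_ite_eq, Finset.mem_univ, if_true, Finset.sum_const, Finset.card_univ,
    Fintype.card_pi, Fintype.card_fin, Finset.prod_const, nsmul_eq_mul, mul_one, Nat.cast_pow]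
  have hS := sum_norm_innerUU_sq_le (N := N) ξ hξ
  obtain rfl | hk := Nat.eq_zero_or_pos k
  · simpa using hS
  obtain rfl | hN := Nat.eq_zero_or_pos N
  · simp [hk.ne']
  have hN' : (0 : ℝ) < N := by exact_mod_cast hN
  have hpow : (1 + 9 / (N : ℝ)) ^ k = ((N : ℝ) + 9) ^ k / (N : ℝ) ^ k := by
    rw [← div_pow]
    congr 1
    field_simp
  rw [hpow]
  calc _ ≤ (((N : ℝ) ^ k)⁻¹) ^ 2 * (((N : ℝ) + 9) ^ k - (N : ℝ) ^ k) := by gcongr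
    _ = _ := by field_simp
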